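/- arXiv:2205.10754 — 2 statements merged into one kernel-verified Lean document; each statement's English description precedes it below -/
import Mathlib

section
/- Let K be an imaginary quadratic field, O an order in K of conductor ℓ_O, and N a positive integer. Then the ray class group C_N(O) = I(O,N)/P_N(O) of the order O modulo NO is isomorphic, as a group, to the generalized ideal class group I(O_K, ℓ_O N)/P_{ℤ,N}(O_K, ℓ_O N). -/
open scoped nonZeroDivisors

set_option synthInstance.maxHeartbeats 1000000
set_option maxHeartbeats 1000000

noncomputable section

variable (K : Type) [Field K] [NumberField K]

/-- The fractional `O`-ideals of `K` (for `O` a subring of `K`). -/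
abbrev Frac (O : Subalgebra ℤ K) := FractionalIdeal ((O : Type))⁰ K

/-- A nonzero ideal `a` of `O` is *prime to* `m` if `a + mO = O`. -/
def primeTo (O : Subalgebra ℤ K) (m : ℕ) (a : Ideal O) : Prop :=
  a ⊔ Ideal.span {(m : O)} = ⊤

/-- `M(O, m)`: the nonzero proper (equivalently, invertible) `O`-ideals prime to `m`. -/
def Mset (O : Subalgebra ℤ K) (m : ℕ) : Set (Ideal O) :=
  {a | a ≠ 0 ∧ primeTo K O m a ∧ IsUnit (a : Frac K O)}

/-- `I(O, m)`: the subgroup of the group of invertible fractional `O`-ideals generated by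
`M(O, m)`. -/
def Igrp (O : Subalgebra ℤ K) (m : ℕ) : Subgroup (Frac K O)ˣ :=
  Subgroup.closure {u | ∃ a ∈ Mset K O m, (u : Frac K O) = a}

/-- `O` is an order of the imaginary quadratic field `K`:  `K` has degree 2 over `ℚ`, has no
real embeddings, and `O` is a subring of `K` which is finitely generated as a ℤ-module and
contains a ℚ-basis of `K` (i.e. spans `K` over ℚ). -/
structure IsImagQuadOrder (O : Subalgebra ℤ K) : Prop where
  degree_two : Module.finrank ℚ K = 2
  no_real_embedding : ∀ v : NumberField.InfinitePlace K, v.IsComplex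
  fg : (Subalgebra.toSubmodule O).FG
  spans : Submodule.span ℚ (O : Set K) = ⊤

/-- `P_N(O, m)`: the subgroup generated by the principal ideals `νO` with `ν ∈ O` nonzero,
`νO` prime to `m`, and `ν ≡ 1 (mod NO)`. -/
def PgrpM (O : Subalgebra ℤ K) (N m : ℕ) : Subgroup (Frac K O)ˣ :=
  Subgroup.closure {u | ∃ ν : (O : Type), ν ≠ 0 ∧ primeTo K O m (Ideal.span {ν}) ∧
    (∃ μ : (O : Type), ν = 1 + (N : (O : Type)) * μ) ∧
    (u : Frac K O) = ((Ideal.span {ν} : Ideal O) : Frac K O)}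

/-- `P_N(O)`: the subgroup generated by the principal ideals `νO` with `ν ∈ O` nonzero and
`ν ≡ 1 (mod NO)`. -/
def Pgrp (O : Subalgebra ℤ K) (N : ℕ) : Subgroup (Frac K O)ˣ :=
  Subgroup.closure {u | ∃ ν : (O : Type), ν ≠ 0 ∧ (∃ μ : (O : Type), ν = 1 + (N : (O : Type)) * μ) ∧
    (u : Frac K O) = ((Ideal.span {ν} : Ideal O) : Frac K O)}

/-- The ray class group `C_N(O) = I(O, N)/P_N(O)` of the order `O` modulo `NO`. -/
abbrev ClsGrp (O : Subalgebra ℤ K) (N : ℕ) :=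
  (Igrp K O N) ⧸ ((Pgrp K O N).subgroupOf (Igrp K O N))

/-- `C_N(O, m) = I(O, m)/P_N(O, m)`. -/
abbrev ClsGrpM (O : Subalgebra ℤ K) (N m : ℕ) :=
  (Igrp K O m) ⧸ ((PgrpM K O N m).subgroupOf (Igrp K O m))

/-- The condOrder `ℓ_O = [O_K : O]`, as the index of `O` in the maximal order (the integral
closure of `ℤ` in `K`) as additive subgroups of `K`. -/
def condOrder (O : Subalgebra ℤ K) : ℕ :=
  AddSubgroup.relIndex (Subalgebra.toSubmodule O).toAddSubgroup
    (Subalgebra.toSubmodule (integralClosure ℤ K)).toAddSubgroup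

/-- `P_{ℤ,N}(O_K, m)`: the subgroup of invertible fractional ideals of the maximal order
`O_K = integralClosure ℤ K` generated by the principal ideals `νO_K` with `ν ∈ O_K` nonzero,
`νO_K` prime to `m`, and `ν ≡ a (mod m O_K)` for some integer `a` with `a ≡ 1 (mod N)`. -/
def PZgrp (N m : ℕ) : Subgroup (Frac K (integralClosure ℤ K))ˣ :=
  Subgroup.closure {u | ∃ ν : ((integralClosure ℤ K : Subalgebra ℤ K) : Type), ν ≠ 0 ∧
    primeTo K (integralClosure ℤ K) m (Ideal.span {ν}) ∧
    (∃ a b : ℤ, a = 1 + (N : ℤ) * b ∧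
      ∃ μ : ((integralClosure ℤ K : Subalgebra ℤ K) : Type),
        ν = (a : ((integralClosure ℤ K : Subalgebra ℤ K) : Type))
            + (m : ((integralClosure ℤ K : Subalgebra ℤ K) : Type)) * μ) ∧
    (u : Frac K (integralClosure ℤ K)) =
      ((Ideal.span {ν} : Ideal (integralClosure ℤ K)) : Frac K (integralClosure ℤ K))}

/-- The generalized ideal class group `I(O_K, m)/P_{ℤ,N}(O_K, m)`. -/
abbrev GenClsGrp (N m : ℕ) :=
  (Igrp K (integralClosure ℤ K) m) ⧸
    ((PZgrp K N m).subgroupOf (Igrp K (integralClosure ℤ K) m))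

/-!
STATEMENT 2: the ray class group `C_N(O) = I(O, N)/P_N(O)` of the order `O` modulo `NO` is
isomorphic as a group to the generalized ideal class group
`I(O_K, ℓ_O N)/P_{ℤ,N}(O_K, ℓ_O N)`.
-/

section IdealLemmas

variable {A B : Type*} [CommRing A] [CommRing B]

theorem Ideal.sup_eq_top_mono {I J : Ideal A} {m n : A} (hIJ : I ≤ J) (hmn : n ∣ m)
    (h : I ⊔ Ideal.span {m} = ⊤) : J ⊔ Ideal.span {n} = ⊤ :=
  top_unique (h ▸ sup_le_sup hIJ (Ideal.span_singleton_le_span_singleton.2 hmn))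

theorem Ideal.sup_span_eq_top_iff {I : Ideal A} {m : A} :
    I ⊔ Ideal.span {m} = ⊤ ↔ ∃ x ∈ I, ∃ y, x = 1 + m * y := by
  rw [Ideal.eq_top_iff_one, Submodule.mem_sup]
  constructor
  · rintro ⟨x, hx, z, hz, h⟩
    obtain ⟨y, rfl⟩ := Ideal.mem_span_singleton.1 hz
    exact ⟨x, hx, -y, by linear_combination h⟩
  · rintro ⟨x, hx, y, rfl⟩
    exact ⟨_, hx, -(m * y), neg_mem (Ideal.mem_span_singleton.2 (dvd_mul_right _ _)), by ring⟩

theorem Ideal.mul_sup_span_eq_top {I J : Ideal A} {m : A} (hI : I ⊔ Ideal.span {m} = ⊤)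
    (hJ : J ⊔ Ideal.span {m} = ⊤) : I * J ⊔ Ideal.span {m} = ⊤ := by
  obtain ⟨x, hx, y, hxy⟩ := Ideal.sup_span_eq_top_iff.1 hI
  obtain ⟨z, hz, w, hzw⟩ := Ideal.sup_span_eq_top_iff.1 hJ
  refine Ideal.sup_span_eq_top_iff.2 ⟨x * z, Ideal.mul_mem_mul hx hz, y + w + m * y * w, ?_⟩
  rw [hxy, hzw]; ring

/-- A nonzero ideal prime to `m` contains a nonzero element congruent to `1` modulo `m`. -/
theorem Ideal.exists_ne_zero_mem_congr_one {I : Ideal A} {m : A} (hI : I ≠ ⊥)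
    (h : I ⊔ Ideal.span {m} = ⊤) : ∃ x ∈ I, x ≠ 0 ∧ ∃ y, x = 1 + m * y := by
  obtain ⟨x, hx, y, hxy⟩ := Ideal.sup_span_eq_top_iff.1 h
  by_cases h0 : x = 0
  · obtain ⟨z, hz, hz0⟩ := Submodule.exists_mem_ne_zero_of_ne_bot hI
    refine ⟨z, hz, hz0, y - y * z, ?_⟩
    rw [h0] at hxy
    linear_combination (1 - z) * hxy
  · exact ⟨x, hx, h0, y, hxy⟩

theorem Ideal.map_sup_span_eq_top (i : A →+* B) {I : Ideal A} {m : ℕ}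
    (h : I ⊔ Ideal.span {(m : A)} = ⊤) : I.map i ⊔ Ideal.span {(m : B)} = ⊤ := by
  have := congrArg (Ideal.map i) h
  rwa [Ideal.map_sup, Ideal.map_span, Set.image_singleton, map_natCast, Ideal.map_top] at this

variable {i : A →+* B} {l m : ℕ}

/-- If `l • B ⊆ A`, contraction inverts extension on ideals of `A` prime to `l`. -/
theorem Ideal.comap_map_of_sup_span_eq_top (hi : Function.Injective i)
    (hl : ∀ b, ∃ a, i a = l * b) (hlm : l ∣ m) {I : Ideal A}
    (h : I ⊔ Ideal.span {(m : A)} = ⊤) : (I.map i).comap i = I := by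
  refine le_antisymm (fun x hx ↦ ?_) Ideal.le_comap_map
  have key : ∀ y ∈ I.map i, ∀ b, ∃ z ∈ I, i z = l * (b * y) := by
    intro y hy
    refine Submodule.span_induction ?_ ?_ ?_ ?_ hy
    · rintro _ ⟨a, ha, rfl⟩ b
      obtain ⟨c, hc⟩ := hl b
      exact ⟨c * a, I.mul_mem_left _ ha, by rw [map_mul, hc, mul_assoc]⟩
    · exact fun b ↦ ⟨0, I.zero_mem, by simp⟩
    · intro x y _ _ hx hy b
      obtain ⟨z, hz, hz'⟩ := hx b
      obtain ⟨w, hw, hw'⟩ := hy b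
      exact ⟨z + w, I.add_mem hz hw, by rw [map_add, hz', hw']; ring⟩
    · intro c x _ hx b
      obtain ⟨z, hz, hz'⟩ := hx (b * c)
      exact ⟨z, hz, by rw [hz', smul_eq_mul]; ring⟩
  obtain ⟨k, rfl⟩ := hlm
  obtain ⟨α, hα, β, hαβ⟩ := Ideal.sup_span_eq_top_iff.1 h
  obtain ⟨z, hz, hz'⟩ := key _ (Ideal.mem_comap.1 hx) 1
  have hz'' : z = l * x := hi (by simpa using hz')
  have : x = x * α - k * β * z := by
    rw [hαβ, hz'']; push_cast; ring
  rw [this]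
  exact I.sub_mem (I.mul_mem_left _ hα) (I.mul_mem_left _ hz)

theorem Ideal.map_comap_of_sup_span_eq_top
    (hl : ∀ b, ∃ a, i a = l * b) (hlm : l ∣ m) {J : Ideal B}
    (h : J ⊔ Ideal.span {(m : B)} = ⊤) : (J.comap i).map i = J := by
  refine le_antisymm Ideal.map_comap_le (fun x hx ↦ ?_)
  obtain ⟨k, rfl⟩ := hlm
  obtain ⟨α, hα, β, hαβ⟩ := Ideal.sup_span_eq_top_iff.1 h
  obtain ⟨b, hb⟩ := hl β
  obtain ⟨z, hz⟩ := hl x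
  have hα' : i (1 + k * b) = α := by
    rw [hαβ, map_add, map_mul, hb]; simp; ring
  have : x = x * i (1 + k * b) - k * β * i z := by
    rw [hα', hαβ, hz]; push_cast; ring
  rw [this]
  refine Ideal.sub_mem _ (Ideal.mul_mem_left _ _ (Ideal.mem_map_of_mem _ ?_))
    (Ideal.mul_mem_left _ _ (Ideal.mem_map_of_mem _ ?_))
  · rwa [Ideal.mem_comap, hα']
  · rw [Ideal.mem_comap, hz]; exact J.mul_mem_left _ hx

theorem Ideal.comap_sup_span_eq_top
    (hl : ∀ b, ∃ a, i a = l * b) (hlm : l ∣ m) {J : Ideal B}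
    (h : J ⊔ Ideal.span {(m : B)} = ⊤) : J.comap i ⊔ Ideal.span {(m : A)} = ⊤ := by
  obtain ⟨k, rfl⟩ := hlm
  obtain ⟨α, hα, β, hαβ⟩ := Ideal.sup_span_eq_top_iff.1 h
  obtain ⟨c, hc⟩ := hl (β ^ 2)
  have : i (1 + (l * k : ℕ) * (-k * c)) = α * (1 - (l * k : ℕ) * β) := by
    simp only [map_add, map_mul, map_one, map_natCast, map_neg, hc, hαβ]; push_cast; ring
  refine Ideal.sup_span_eq_top_iff.2 ⟨1 + (l * k : ℕ) * (-k * c), ?_, -k * c, rfl⟩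
  rw [Ideal.mem_comap, this]
  exact J.mul_mem_right _ hα

/-- If `l • B ⊆ A` and `B` is Dedekind, the contraction of an ideal of `B` prime to `l` divides
a nonzero principal ideal. -/
theorem Ideal.exists_comap_mul_eq_span [IsDedekindDomain B] (hi : Function.Injective i)
    (hl : ∀ b, ∃ a, i a = l * b) (hlm : l ∣ m) {J : Ideal B} (hJ : J.comap i ≠ ⊥)
    (h : J ⊔ Ideal.span {(m : B)} = ⊤) :
    ∃ (I : Ideal A) (x : A), x ≠ 0 ∧ J.comap i * I = Ideal.span {x} := by
  have hc := Ideal.comap_sup_span_eq_top hl hlm h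
  obtain ⟨x, hx, hx0, y, hxy⟩ := Ideal.exists_ne_zero_mem_congr_one hJ hc
  have hxm : Ideal.span {x} ⊔ Ideal.span {(m : A)} = ⊤ :=
    Ideal.sup_span_eq_top_iff.2 ⟨x, Ideal.mem_span_singleton_self x, y, hxy⟩
  obtain ⟨J', hJ'⟩ := Ideal.dvd_span_singleton.2 (Ideal.mem_comap.1 hx)
  have hJ'm : J' ⊔ Ideal.span {(m : B)} = ⊤ := by
    refine Ideal.sup_eq_top_mono ?_ dvd_rfl (Ideal.map_sup_span_eq_top i hxm)
    rw [Ideal.map_span, Set.image_singleton, hJ']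
    exact Ideal.mul_le_right
  refine ⟨J'.comap i, x, hx0, ?_⟩
  rw [← Ideal.comap_map_of_sup_span_eq_top hi hl hlm
      (Ideal.mul_sup_span_eq_top hc (Ideal.comap_sup_span_eq_top hl hlm hJ'm)),
    Ideal.map_mul, Ideal.map_comap_of_sup_span_eq_top hl hlm h,
    Ideal.map_comap_of_sup_span_eq_top hl hlm hJ'm, ← hJ', ← Set.image_singleton,
    ← Ideal.map_span, Ideal.comap_map_of_sup_span_eq_top hi hl hlm hxm]

/-- Chinese remainder theorem for elements of an ideal `I`, modulo multiples of `I`. -/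
theorem Ideal.exists_mem_forall_sub_mem_mul {ι : Type*} [Finite ι] {f : ι → Ideal A}
    (hf : Pairwise (Function.onFun IsCoprime f)) {I : Ideal A} {g : ι → A} (hg : ∀ j, g j ∈ I) :
    ∃ x ∈ I, ∀ j, x - g j ∈ I * f j := by
  classical
  have := Fintype.ofFinite ι
  choose e he using fun j ↦ Ideal.exists_forall_sub_mem_ideal hf (Pi.single j (1 : A))
  refine ⟨∑ j, g j * e j, I.sum_mem fun j _ ↦ I.mul_mem_right _ (hg j), fun k ↦ ?_⟩
  have : ∑ j, g j * e j - g k = ∑ j, g j * (e j - Pi.single (M := fun _ ↦ A) j 1 k) := by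
    simp [mul_sub, Pi.single_apply]
  rw [this]
  exact Ideal.sum_mem _ fun j _ ↦ Ideal.mul_mem_mul (hg j) (he j k)

/-- A nonzero ideal prime to `n` that differs from all its multiples by maximal ideals contains,
for each `m` lying in finitely many maximal ideals, a nonzero element congruent to
`1` modulo `n` that generates it at all maximal ideals containing `m`. -/
theorem Ideal.exists_mem_congr_one_forall_notMem_mul {I : Ideal A} {m n : A}
    (hfin : {P : Ideal A | P.IsMaximal ∧ m ∈ P}.Finite) (hI0 : I ≠ ⊥)
    (hn : I ⊔ Ideal.span {n} = ⊤) (hI : ∀ P : Ideal A, P.IsMaximal → I * P ≠ I) :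
    ∃ x ∈ I, x ≠ 0 ∧ (∃ y, x = 1 + n * y) ∧
      ∀ P : Ideal A, P.IsMaximal → m ∈ P → x ∉ I * P := by
  suffices h : ∃ x ∈ I, (∃ y, x = 1 + n * y) ∧
      ∀ P : Ideal A, P.IsMaximal → m ∈ P → x ∉ I * P by
    obtain ⟨x, hx, hy, hP⟩ := h
    by_cases h0 : x = 0
    · have hmax : ∀ P : Ideal A, P.IsMaximal → m ∉ P := fun P hP' hm ↦
        hP P hP' hm (h0 ▸ zero_mem _)
      obtain ⟨z, hz, hz0, hz1⟩ := Ideal.exists_ne_zero_mem_congr_one hI0 hn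
      exact ⟨z, hz, hz0, hz1, fun P hP hm ↦ absurd hm (hmax P hP)⟩
    · exact ⟨x, hx, h0, hy, hP⟩
  let S := {P : Ideal A | (P.IsMaximal ∧ m ∈ P) ∧ n ∉ P}
  have : Finite S := hfin.subset fun P hP ↦ hP.1
  obtain ⟨e, he, y, hy⟩ := Ideal.sup_span_eq_top_iff.1 hn
  have hg : ∀ P : S, ∃ x ∈ I, x ∉ I * P.1 := fun P ↦
    SetLike.not_le_iff_exists.1 fun h ↦ hI P.1 P.2.1.1 (le_antisymm Ideal.mul_le_left h)
  choose g hgI hg using hg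
  have hcop : Pairwise (Function.onFun IsCoprime
      (fun o : Option S ↦ o.elim (Ideal.span {n}) Subtype.val)) := by
    have hnP (P : S) : IsCoprime (Ideal.span {n}) P.1 := by
      rw [Ideal.isCoprime_iff_sup_eq, sup_comm]
      exact P.2.1.1.out.2 _ (left_lt_sup.2 fun h ↦ P.2.2 (h (Ideal.mem_span_singleton_self n)))
    rintro (_ | P) (_ | Q) h
    · exact absurd rfl h
    · exact hnP Q
    · exact (hnP P).symm
    · exact Ideal.isCoprime_iff_sup_eq.2
        (P.2.1.1.coprime_of_ne Q.2.1.1 fun h' ↦ h (congrArg some (Subtype.ext h')))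
  obtain ⟨x, hx, hxg⟩ := Ideal.exists_mem_forall_sub_mem_mul hcop (I := I)
    (g := fun o ↦ o.elim e g) (by rintro (_ | P); exacts [he, hgI P])
  obtain ⟨z, hz⟩ := Ideal.mem_span_singleton.1 (Ideal.mul_le_right (hxg none))
  have hx1 : x = 1 + n * (y + z) := by
    have hz' : x - e = n * z := hz
    linear_combination hz' + hy
  refine ⟨x, hx, ⟨_, hx1⟩, fun P hP hm hxP ↦ ?_⟩
  by_cases hnP : n ∈ P
  · refine hP.ne_top ((Ideal.eq_top_iff_one P).2 ?_)
    have : (1 : A) = x - (y + z) * n := by rw [hx1]; ring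
    rw [this]
    exact P.sub_mem (Ideal.mul_le_right hxP) (P.mul_mem_left _ hnP)
  · refine hg ⟨P, ⟨hP, hm⟩, hnP⟩ ?_
    have := Ideal.sub_mem _ hxP (hxg (some ⟨P, ⟨hP, hm⟩, hnP⟩))
    simpa using this

theorem Ideal.finite_setOf_isMaximal_mem [IsDomain A] [Module.Finite ℤ A] [Module.Free ℤ A]
    {m : A} (hm : m ≠ 0) : {P : Ideal A | P.IsMaximal ∧ m ∈ P}.Finite := by
  have : Finite (A ⧸ Ideal.span {m}) := Ideal.finiteQuotientOfFreeOfNeBot _ (by simpa using hm)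
  have : Finite (Ideal (A ⧸ Ideal.span {m})) := Finite.of_injective _ SetLike.coe_injective
  refine (Set.finite_range (Ideal.comap (Ideal.Quotient.mk (Ideal.span {m})))).subset ?_
  rintro P ⟨-, hP⟩
  exact ⟨P.map (Ideal.Quotient.mk _),
    Ideal.comap_map_mk (by simpa using hP)⟩

end IdealLemmas

section FractionalIdealLemmas

variable {R F : Type*} [CommRing R] [Field F] [Algebra R F] [IsFractionRing R F]

theorem FractionalIdeal.isUnit_coeIdeal_span_singleton {x : R} (hx : x ≠ 0) :
    IsUnit ((Ideal.span {x} : Ideal R) : FractionalIdeal R⁰ F) := by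
  have hx' : algebraMap R F x ≠ 0 :=
    fun h ↦ hx (IsFractionRing.injective R F (by rw [h, map_zero]))
  rw [FractionalIdeal.coeIdeal_span_singleton]
  refine IsUnit.of_mul_eq_one (FractionalIdeal.spanSingleton R⁰ (algebraMap R F x)⁻¹) ?_
  rw [FractionalIdeal.spanSingleton_mul_spanSingleton, mul_inv_cancel₀ hx',
    FractionalIdeal.spanSingleton_one]

theorem Ideal.isUnit_coeIdeal_and_of_mul_eq_span {I J : Ideal R} {x : R} (hx : x ≠ 0)
    (h : I * J = Ideal.span {x}) :
    IsUnit (I : FractionalIdeal R⁰ F) ∧ IsUnit (J : FractionalIdeal R⁰ F) := by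
  rw [← IsUnit.mul_iff, ← FractionalIdeal.coeIdeal_mul, h]
  exact FractionalIdeal.isUnit_coeIdeal_span_singleton hx

theorem Ideal.exists_mul_eq_span_of_isUnit {I : Ideal R}
    (hI : IsUnit (I : FractionalIdeal R⁰ F)) {x : R} (hx : x ∈ I) :
    ∃ J : Ideal R, I * J = Ideal.span {x} := by
  obtain ⟨I', hI'⟩ := hI.exists_right_inv
  have hle : ((Ideal.span {x} : Ideal R) : FractionalIdeal R⁰ F) * I' ≤ 1 := by
    rw [← hI']
    exact mul_le_mul_left
      ((FractionalIdeal.coeIdeal_le_coeIdeal F).2 ((Ideal.span_singleton_le_iff_mem _).2 hx)) _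
  obtain ⟨J, hJ⟩ := FractionalIdeal.le_one_iff_exists_coeIdeal.1 hle
  refine ⟨J, FractionalIdeal.coeIdeal_injective (K := F) ?_⟩
  simp only [FractionalIdeal.coeIdeal_mul]
  rw [hJ, mul_left_comm, hI', mul_one]

theorem Ideal.mul_ne_self_of_isUnit {I P : Ideal R}
    (hI : IsUnit (I : FractionalIdeal R⁰ F)) (hP : P ≠ ⊤) : I * P ≠ I := by
  intro h
  refine hP (Ideal.one_eq_top (R := R) ▸ FractionalIdeal.coeIdeal_injective (K := F) ?_)
  refine hI.mul_left_cancel ?_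
  simp only [← FractionalIdeal.coeIdeal_mul, h, mul_one]

theorem Ideal.ne_bot_of_isUnit_coeIdeal {I : Ideal R}
    (hI : IsUnit (I : FractionalIdeal R⁰ F)) : I ≠ ⊥ := by
  rintro rfl
  have : Nontrivial R := (IsFractionRing.nontrivial_iff_nontrivial R F).2 inferInstance
  exact hI.ne_zero (by simp)

end FractionalIdealLemmas

theorem Subgroup.exists_div_of_mem_closure {G : Type*} [CommGroup G] (M : Submonoid G) {x : G}
    (hx : x ∈ Subgroup.closure (M : Set G)) : ∃ s ∈ M, ∃ t ∈ M, x = s / t := by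
  induction hx using Subgroup.closure_induction with
  | mem x hx => exact ⟨x, hx, 1, M.one_mem, by simp⟩
  | one => exact ⟨1, M.one_mem, 1, M.one_mem, by simp⟩
  | mul x y _ _ hx hy =>
    obtain ⟨s, hs, t, ht, rfl⟩ := hx
    obtain ⟨s', hs', t', ht', rfl⟩ := hy
    exact ⟨s * s', M.mul_mem hs hs', t * t', M.mul_mem ht ht', div_mul_div_comm _ _ _ _⟩
  | inv x _ hx =>
    obtain ⟨s, hs, t, ht, rfl⟩ := hx
    exact ⟨t, ht, s, hs, inv_div _ _⟩

section Order

variable {K}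
variable {O : Subalgebra ℤ K}

theorem IsImagQuadOrder.exists_smul_mem (hO : IsImagQuadOrder K O) (z : K) :
    ∃ n : ℤ, n ≠ 0 ∧ n • z ∈ O := by
  have hz : z ∈ Submodule.span ℚ (O : Set K) := hO.spans ▸ Submodule.mem_top
  induction hz using Submodule.span_induction with
  | mem x hx => exact ⟨1, one_ne_zero, by simpa using hx⟩
  | zero => exact ⟨1, one_ne_zero, by simp⟩
  | add x y _ _ hx hy =>
    obtain ⟨n, hn, hx⟩ := hx
    obtain ⟨m, hm, hy⟩ := hy
    refine ⟨n * m, mul_ne_zero hn hm, ?_⟩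
    rw [smul_add]
    refine add_mem ?_ ?_
    · rw [mul_comm, mul_smul]; exact O.smul_mem hx m
    · rw [mul_smul]; exact O.smul_mem hy n
  | smul q x _ hx =>
    obtain ⟨n, hn, hx⟩ := hx
    refine ⟨q.den * n, mul_ne_zero (by exact_mod_cast q.den_nz) hn, ?_⟩
    have : ((q.den : ℤ) * n) • q • x = q.num • n • x := by
      simp only [zsmul_eq_mul, Rat.smul_def]
      have : (q.den : K) * q = q.num := by exact_mod_cast Rat.den_mul_eq_num q
      push_cast
      linear_combination (n : K) * x * this
    rw [this]
    exact O.smul_mem hx _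

theorem IsImagQuadOrder.isFractionRing (hO : IsImagQuadOrder K O) : IsFractionRing O K := by
  refine IsFractionRing.of_field O K fun z ↦ ?_
  obtain ⟨n, hn, hz⟩ := hO.exists_smul_mem z
  refine ⟨⟨_, hz⟩, (n : O), ?_⟩
  have : (n : K) ≠ 0 := by exact_mod_cast hn
  rw [map_intCast, eq_div_iff this, mul_comm, ← zsmul_eq_mul]
  rfl

theorem IsImagQuadOrder.moduleFinite (hO : IsImagQuadOrder K O) : Module.Finite ℤ O :=
  Module.Finite.iff_fg.2 hO.fg

theorem IsImagQuadOrder.le_integralClosure (hO : IsImagQuadOrder K O) :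
    O ≤ integralClosure ℤ K := by
  have := hO.moduleFinite
  intro x hx
  exact (Algebra.IsIntegral.isIntegral (R := ℤ) (⟨x, hx⟩ : O)).map O.val

instance integralClosure.instModuleFinite : Module.Finite ℤ (integralClosure ℤ K) :=
  inferInstanceAs (Module.Finite ℤ (NumberField.RingOfIntegers K))

instance integralClosure.instModuleFree : Module.Free ℤ (integralClosure ℤ K) :=
  inferInstanceAs (Module.Free ℤ (NumberField.RingOfIntegers K))

instance integralClosure.instIsDedekindDomain : IsDedekindDomain (integralClosure ℤ K) :=
  inferInstanceAs (IsDedekindDomain (NumberField.RingOfIntegers K))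

instance integralClosure.instIsFractionRing : IsFractionRing (integralClosure ℤ K) K :=
  inferInstanceAs (IsFractionRing (NumberField.RingOfIntegers K) K)

/-- The inclusion of an order into the maximal order. -/
def IsImagQuadOrder.incl (hO : IsImagQuadOrder K O) : O →+* integralClosure ℤ K :=
  (Subalgebra.inclusion hO.le_integralClosure : O →+* integralClosure ℤ K)

theorem IsImagQuadOrder.coe_incl (hO : IsImagQuadOrder K O) (x : O) :
    (hO.incl x : K) = x := rfl

theorem IsImagQuadOrder.incl_injective (hO : IsImagQuadOrder K O) :
    Function.Injective hO.incl :=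
  Subalgebra.inclusion_injective hO.le_integralClosure

theorem condOrder_eq_index (hO : IsImagQuadOrder K O) :
    condOrder K O = hO.incl.toAddMonoidHom.range.index := by
  rw [condOrder, AddSubgroup.relIndex]
  congr 1
  ext x
  exact ⟨fun hx ↦ ⟨⟨x, hx⟩, rfl⟩, fun ⟨y, hy⟩ ↦ hy ▸ y.2⟩

theorem IsImagQuadOrder.exists_incl_eq (hO : IsImagQuadOrder K O) (b : integralClosure ℤ K) :
    ∃ a, hO.incl a = (condOrder K O : integralClosure ℤ K) * b := by
  have := hO.incl.toAddMonoidHom.range.nsmul_index_mem b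
  rw [← condOrder_eq_index, nsmul_eq_mul] at this
  exact this

theorem IsImagQuadOrder.condOrder_ne_zero (hO : IsImagQuadOrder K O) : condOrder K O ≠ 0 := by
  rw [condOrder_eq_index hO]
  let H := LinearMap.range (hO.incl.toAddMonoidHom.toIntLinearMap)
  have : Finite (integralClosure ℤ K ⧸ H) := by
    refine Module.finite_of_fg_torsion _ ?_
    intro x
    obtain ⟨x, rfl⟩ := Submodule.Quotient.mk_surjective _ x
    obtain ⟨n, hn, hx⟩ := hO.exists_smul_mem (x : K)
    refine ⟨⟨n, mem_nonZeroDivisors_of_ne_zero hn⟩, ?_⟩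
    rw [Submonoid.mk_smul, ← Submodule.Quotient.mk_smul, Submodule.Quotient.mk_eq_zero]
    exact ⟨⟨_, hx⟩, Subtype.ext rfl⟩
  have : Finite (integralClosure ℤ K ⧸ H.toAddSubgroup) := this
  exact H.toAddSubgroup.index_ne_zero_of_finite

/-- The maximal order of a quadratic field maps onto `ℤ` with kernel `ℤ`. -/
theorem IsImagQuadOrder.exists_surjective_ker (hO : IsImagQuadOrder K O) :
    ∃ f : integralClosure ℤ K →+ ℤ, Function.Surjective f ∧
      ∀ x, f x = 0 ↔ ∃ n : ℤ, x = n := by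
  let Z : Submodule ℤ (integralClosure ℤ K) := Submodule.span ℤ {1}
  have hZ : Module.finrank ℤ Z = 1 :=
    (LinearEquiv.toSpanNonzeroSingleton ℤ _ (1 : integralClosure ℤ K)
      one_ne_zero).finrank_eq.symm.trans (Module.finrank_self ℤ)
  have hK : Module.finrank ℤ (integralClosure ℤ K) = 2 :=
    (NumberField.RingOfIntegers.rank K).trans hO.degree_two
  have hQ : Module.finrank ℤ (integralClosure ℤ K ⧸ Z) = 1 := by
    have := Z.finrank_quotient_add_finrank
    omega
  have : Module.IsTorsionFree ℤ (integralClosure ℤ K ⧸ Z) := by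
    refine .of_smul_eq_zero fun n x h ↦ ?_
    obtain ⟨x, rfl⟩ := Submodule.Quotient.mk_surjective _ x
    rw [or_iff_not_imp_left]
    intro hn
    rw [← Submodule.Quotient.mk_smul, Submodule.Quotient.mk_eq_zero,
      Submodule.mem_span_singleton] at h
    rw [Submodule.Quotient.mk_eq_zero, Submodule.mem_span_singleton]
    obtain ⟨k, hk⟩ := h
    have hk' : (k : K) = n * (x : K) := by
      have := congrArg (Subtype.val) hk
      simpa [zsmul_eq_mul] using this
    have hx : (x : K) = algebraMap ℚ K (k / n) := by
      have : (n : K) ≠ 0 := by exact_mod_cast hn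
      simp only [map_div₀, map_intCast]
      rw [eq_div_iff this, hk', mul_comm]
    have hint : IsIntegral ℤ ((k : ℚ) / n) := by
      rw [← isIntegral_algebraMap_iff (algebraMap ℚ K).injective, ← hx]
      exact x.2
    obtain ⟨t, ht⟩ := IsIntegrallyClosed.isIntegral_iff.1 hint
    refine ⟨t, Subtype.ext ?_⟩
    rw [hx, ← ht]
    simp
  have : Module.Free ℤ (integralClosure ℤ K ⧸ Z) := inferInstance
  let e := LinearEquiv.ofFinrankEq
    (integralClosure ℤ K ⧸ Z) ℤ (hQ.trans (Module.finrank_self ℤ).symm)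
  refine ⟨(e.toLinearMap ∘ₗ Z.mkQ).toAddMonoidHom,
    e.surjective.comp (Submodule.mkQ_surjective Z), fun x ↦ ?_⟩
  change e (Z.mkQ x) = 0 ↔ _
  rw [LinearEquiv.map_eq_zero_iff, Submodule.mkQ_apply, Submodule.Quotient.mk_eq_zero,
    Submodule.mem_span_singleton]
  simp [eq_comm]

/-- `O ⊆ ℤ + ℓ_O O_K`. -/
theorem IsImagQuadOrder.exists_eq_add (hO : IsImagQuadOrder K O) (x : O) :
    ∃ (n : ℤ) (b : integralClosure ℤ K),
      hO.incl x = n + (condOrder K O : integralClosure ℤ K) * b := by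
  obtain ⟨f, hf, hker⟩ := hO.exists_surjective_ker
  let H := hO.incl.toAddMonoidHom.range
  have hle : f.ker ≤ H := fun y hy ↦ by
    obtain ⟨n, rfl⟩ := (hker y).1 hy
    exact ⟨n, map_intCast hO.incl n⟩
  have hidx : (H.map f).index = condOrder K O := by
    rw [AddSubgroup.index_map_eq H hf hle, condOrder_eq_index hO]
  obtain ⟨k, hk⟩ := Int.subgroup_cyclic (H.map f)
  rw [← AddSubgroup.zmultiples_eq_closure] at hk
  rw [hk, Int.index_zmultiples] at hidx
  have hx : f (hO.incl x) ∈ H.map f := ⟨_, ⟨x, rfl⟩, rfl⟩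
  rw [hk, Int.mem_zmultiples_iff, ← Int.natAbs_dvd, hidx] at hx
  obtain ⟨t, ht⟩ := hx
  obtain ⟨b, rfl⟩ := hf t
  obtain ⟨n, hn⟩ := (hker (hO.incl x - (condOrder K O : integralClosure ℤ K) * b)).1 (by
    rw [map_sub, ht, ← nsmul_eq_mul, ← nsmul_eq_mul, map_nsmul, sub_self])
  exact ⟨n, b, by rw [← hn]; ring⟩

end Order

section ClassGroups

variable {K}
variable {O : Subalgebra ℤ K}

theorem exists_div_of_mem_Igrp {m : ℕ} {u : (Frac K O)ˣ} (hu : u ∈ Igrp K O m) :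
    ∃ s t : (Frac K O)ˣ, u = s / t ∧ (∃ a ∈ Mset K O m, (s : Frac K O) = a) ∧
      ∃ a ∈ Mset K O m, (t : Frac K O) = a := by
  let M : Submonoid (Frac K O)ˣ :=
    { carrier := {u | ∃ a ∈ Mset K O m, (u : Frac K O) = a}
      one_mem' := ⟨1, ⟨one_ne_zero, by simp [primeTo, Ideal.one_eq_top], by simp⟩, by simp⟩
      mul_mem' := by
        rintro u v ⟨a, ⟨ha0, ha, ha'⟩, hu⟩ ⟨b, ⟨hb0, hb, hb'⟩, hv⟩
        refine ⟨a * b, ⟨mul_ne_zero ha0 hb0, Ideal.mul_sup_span_eq_top ha hb, ?_⟩, ?_⟩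
        · rw [FractionalIdeal.coeIdeal_mul]; exact ha'.mul hb'
        · rw [FractionalIdeal.coeIdeal_mul, Units.val_mul, hu, hv] }
  obtain ⟨s, hs, t, ht, h⟩ := Subgroup.exists_div_of_mem_closure M hu
  exact ⟨s, t, h, hs, ht⟩

theorem exists_div_of_mem_Pgrp {N : ℕ} {u : (Frac K O)ˣ} (hu : u ∈ Pgrp K O N) :
    ∃ s t : (Frac K O)ˣ, u = s / t ∧
      (∃ ν : O, ν ≠ 0 ∧ (∃ μ : O, ν = 1 + (N : O) * μ) ∧
        (s : Frac K O) = ((Ideal.span {ν} : Ideal O) : Frac K O)) ∧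
      ∃ ν : O, ν ≠ 0 ∧ (∃ μ : O, ν = 1 + (N : O) * μ) ∧
        (t : Frac K O) = ((Ideal.span {ν} : Ideal O) : Frac K O) := by
  let M : Submonoid (Frac K O)ˣ :=
    { carrier := {u | ∃ ν : O, ν ≠ 0 ∧ (∃ μ : O, ν = 1 + (N : O) * μ) ∧
        (u : Frac K O) = ((Ideal.span {ν} : Ideal O) : Frac K O)}
      one_mem' := ⟨1, one_ne_zero, ⟨0, by simp⟩, by simp⟩
      mul_mem' := by
        rintro u v ⟨a, ha0, ⟨c, ha⟩, hu⟩ ⟨b, hb0, ⟨d, hb⟩, hv⟩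
        refine ⟨a * b, mul_ne_zero ha0 hb0, ⟨c + d + N * c * d, ?_⟩, ?_⟩
        · rw [ha, hb]; ring
        · rw [← Ideal.span_singleton_mul_span_singleton, FractionalIdeal.coeIdeal_mul,
            Units.val_mul, hu, hv] }
  obtain ⟨s, hs, t, ht, h⟩ := Subgroup.exists_div_of_mem_closure M hu
  exact ⟨s, t, h, hs, ht⟩

theorem mem_Mset_mono {m n : ℕ} (h : n ∣ m) {a : Ideal O} (ha : a ∈ Mset K O m) :
    a ∈ Mset K O n :=
  ⟨ha.1, Ideal.sup_eq_top_mono le_rfl (Nat.cast_dvd_cast h) ha.2.1, ha.2.2⟩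

theorem Igrp_anti {m n : ℕ} (h : n ∣ m) : Igrp K O m ≤ Igrp K O n :=
  Subgroup.closure_mono fun _ ⟨a, ha, hu⟩ ↦ ⟨a, mem_Mset_mono h ha, hu⟩

theorem span_singleton_mem_Mset [IsFractionRing O K] {m : ℕ} {x : O} (hx : x ≠ 0)
    (h : primeTo K O m (Ideal.span {x})) : Ideal.span {x} ∈ Mset K O m :=
  ⟨by simpa using hx, h, FractionalIdeal.isUnit_coeIdeal_span_singleton hx⟩

/-- Extension of invertible fractional ideals from an order to the maximal order. -/
def IsImagQuadOrder.extend (hO : IsImagQuadOrder K O) :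
    (Frac K O)ˣ →* (Frac K (integralClosure ℤ K))ˣ :=
  haveI := hO.isFractionRing
  Units.map (FractionalIdeal.extendedHom' (f := hO.incl) K
    (nonZeroDivisors_le_comap_nonZeroDivisors_of_injective _ hO.incl_injective)).toMonoidHom

theorem IsImagQuadOrder.extend_coe (hO : IsImagQuadOrder K O) {u : (Frac K O)ˣ} {a : Ideal O}
    (h : (u : Frac K O) = a) :
    (hO.extend u : Frac K (integralClosure ℤ K)) = (a.map hO.incl : Ideal _) := by
  have := hO.isFractionRing
  rw [← FractionalIdeal.extended_coeIdeal_eq_map (K := K) K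
    (nonZeroDivisors_le_comap_nonZeroDivisors_of_injective _ hO.incl_injective), ← h]
  rfl

theorem IsImagQuadOrder.map_mem_Mset (hO : IsImagQuadOrder K O) {m : ℕ} {a : Ideal O}
    (ha : a ∈ Mset K O m) : a.map hO.incl ∈ Mset K (integralClosure ℤ K) m := by
  have hu : IsUnit ((a.map hO.incl : Ideal _) : Frac K (integralClosure ℤ K)) := by
    rw [← hO.extend_coe ha.2.2.unit_spec]
    exact Units.isUnit _
  exact ⟨Ideal.ne_bot_of_isUnit_coeIdeal hu, Ideal.map_sup_span_eq_top _ ha.2.1, hu⟩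

theorem IsImagQuadOrder.extend_mem_Igrp (hO : IsImagQuadOrder K O) {m : ℕ} {u : (Frac K O)ˣ}
    (hu : u ∈ Igrp K O m) : hO.extend u ∈ Igrp K (integralClosure ℤ K) m := by
  have : Igrp K O m ≤ (Igrp K (integralClosure ℤ K) m).comap hO.extend :=
    (Subgroup.closure_le _).2 fun v ⟨a, ha, hv⟩ ↦
      Subgroup.subset_closure ⟨_, hO.map_mem_Mset ha, hO.extend_coe hv⟩
  exact this hu

theorem IsImagQuadOrder.eq_one_of_extend_eq_one (hO : IsImagQuadOrder K O) {m : ℕ}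
    (hm : condOrder K O ∣ m) {u : (Frac K O)ˣ} (hu : u ∈ Igrp K O m) (h : hO.extend u = 1) :
    u = 1 := by
  obtain ⟨s, t, rfl, ⟨a, ha, hs⟩, b, hb, ht⟩ := exists_div_of_mem_Igrp hu
  rw [map_div, div_eq_one] at h
  have h' := congrArg (Units.val) h
  rw [hO.extend_coe hs, hO.extend_coe ht] at h'
  have hab : a = b := by
    rw [← Ideal.comap_map_of_sup_span_eq_top hO.incl_injective hO.exists_incl_eq hm ha.2.1,
      FractionalIdeal.coeIdeal_injective (K := K) h',
      Ideal.comap_map_of_sup_span_eq_top hO.incl_injective hO.exists_incl_eq hm hb.2.1]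
  rw [div_eq_one, Units.ext_iff, hs, ht, hab]

theorem IsImagQuadOrder.exists_extend_eq (hO : IsImagQuadOrder K O) {m : ℕ}
    (hm : condOrder K O ∣ m) {w : (Frac K (integralClosure ℤ K))ˣ}
    (hw : w ∈ Igrp K (integralClosure ℤ K) m) : ∃ u ∈ Igrp K O m, hO.extend u = w := by
  have := hO.isFractionRing
  suffices Igrp K (integralClosure ℤ K) m ≤ (Igrp K O m).map hO.extend from this hw
  refine (Subgroup.closure_le _).2 ?_
  rintro v ⟨J, ⟨hJ0, hJ, -⟩, hv⟩
  have hmap := Ideal.map_comap_of_sup_span_eq_top hO.exists_incl_eq hm hJ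
  have h0 : J.comap hO.incl ≠ ⊥ := fun h ↦ hJ0 (by rw [← hmap, h, Ideal.map_bot]; rfl)
  obtain ⟨I, x, hx, hI⟩ := Ideal.exists_comap_mul_eq_span hO.incl_injective hO.exists_incl_eq hm
    h0 hJ
  have hu := (Ideal.isUnit_coeIdeal_and_of_mul_eq_span (F := K) hx hI).1
  refine ⟨hu.unit, Subgroup.subset_closure ⟨_, ⟨h0,
    Ideal.comap_sup_span_eq_top hO.exists_incl_eq hm hJ, hu⟩, hu.unit_spec⟩, Units.ext ?_⟩
  rw [hO.extend_coe hu.unit_spec, hmap, hv]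

theorem IsImagQuadOrder.extend_mem_PZgrp_of_eq_span (hO : IsImagQuadOrder K O) {N : ℕ}
    {u : (Frac K O)ˣ} {ν μ : O} (h0 : ν ≠ 0)
    (hν : primeTo K O (condOrder K O * N) (Ideal.span {ν})) (h : ν = 1 + (N : O) * μ)
    (hu : (u : Frac K O) = ((Ideal.span {ν} : Ideal O) : Frac K O)) :
    hO.extend u ∈ PZgrp K N (condOrder K O * N) := by
  obtain ⟨n, b, hb⟩ := hO.exists_eq_add μ
  have hmap : (Ideal.span {ν}).map hO.incl = Ideal.span {hO.incl ν} := by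
    rw [Ideal.map_span, Set.image_singleton]
  refine Subgroup.subset_closure ⟨hO.incl ν, ?_, ?_, ⟨1 + N * n, n, rfl, b, ?_⟩, ?_⟩
  · exact (map_ne_zero_iff _ hO.incl_injective).2 h0
  · exact hmap ▸ Ideal.map_sup_span_eq_top hO.incl hν
  · rw [h, map_add, map_mul, hb, map_one, map_natCast]
    push_cast
    ring
  · rw [hO.extend_coe hu, hmap]

theorem IsImagQuadOrder.exists_incl_eq_of_congr (hO : IsImagQuadOrder K O) {N : ℕ}
    {ν μ : integralClosure ℤ K} {b : ℤ}
    (hν : primeTo K (integralClosure ℤ K) (condOrder K O * N) (Ideal.span {ν}))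
    (h : ν = ((1 + N * b : ℤ) : integralClosure ℤ K) +
      ((condOrder K O * N : ℕ) : integralClosure ℤ K) * μ) :
    ∃ ν' μ' : O, hO.incl ν' = ν ∧ ν' = 1 + (N : O) * μ' ∧
      primeTo K O (condOrder K O * N) (Ideal.span {ν'}) := by
  obtain ⟨c, hc⟩ := hO.exists_incl_eq μ
  obtain ⟨d, hd⟩ := hO.exists_incl_eq (μ ^ 2)
  have hν' : hO.incl (1 + N * (b + c)) = ν := by
    simp only [map_add, map_mul, map_one, map_natCast, map_intCast, hc, h]
    push_cast
    ring
  refine ⟨1 + N * (b + c), b + c, hν', rfl, ?_⟩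
  have hcop : IsCoprime (1 + N * b) ((condOrder K O * N : ℕ) : ℤ) := by
    rw [Int.isCoprime_iff_gcd_eq_one]
    obtain ⟨_, hx, y, hxy⟩ := Ideal.sup_span_eq_top_iff.1 hν
    obtain ⟨x, rfl⟩ := Ideal.mem_span_singleton.1 hx
    set g := Int.gcd (1 + N * b) ((condOrder K O * N : ℕ) : ℤ)
    obtain ⟨p, hp⟩ : (g : ℤ) ∣ 1 + N * b := Int.gcd_dvd_left ..
    obtain ⟨q, hq⟩ : (g : ℤ) ∣ ((condOrder K O * N : ℕ) : ℤ) := Int.gcd_dvd_right ..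
    have hq' : ((condOrder K O * N : ℕ) : integralClosure ℤ K) = g * q := by exact_mod_cast hq
    have hg : algebraMap ℤ (integralClosure ℤ K) g * (p * x + q * μ * x - q * y) = 1 := by
      rw [h, hp, hq'] at hxy
      push_cast at hxy ⊢
      linear_combination hxy
    have := isUnit_of_map_unit (algebraMap ℤ (integralClosure ℤ K)) (g : ℤ) (.of_mul_eq_one _ hg)
    simpa [Int.isUnit_iff_natAbs_eq] using this
  obtain ⟨r, s, hrs⟩ := hcop
  set m : ℕ := condOrder K O * N
  have hrs' : (r : O) * (1 + N * b) + s * m = 1 := by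
    exact_mod_cast congrArg (Int.cast (R := O)) hrs
  have hm : (m : O) = condOrder K O * N := Nat.cast_mul _ _
  have hcd : c ^ 2 = condOrder K O * d := hO.incl_injective (by
    simp only [map_pow, map_mul, map_natCast, hc, hd]
    ring)
  refine Ideal.sup_span_eq_top_iff.2 ⟨(1 + N * (b + c)) * (r * (1 - (N * r * c - m * s))),
    Ideal.mul_mem_right _ _ (Ideal.mem_span_singleton_self _),
    -(N * r ^ 2 * d - 2 * r * s * N * c + m * s ^ 2), ?_⟩
  linear_combination (1 - (N * r * c - m * s)) * hrs' - N ^ 2 * r ^ 2 * hcd +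
    N * r ^ 2 * d * hm

theorem IsImagQuadOrder.exists_extend_eq_of_mem_PZgrp (hO : IsImagQuadOrder K O) {N : ℕ}
    {w : (Frac K (integralClosure ℤ K))ˣ} (hw : w ∈ PZgrp K N (condOrder K O * N)) :
    ∃ u ∈ Igrp K O (condOrder K O * N), u ∈ Pgrp K O N ∧ hO.extend u = w := by
  have := hO.isFractionRing
  suffices PZgrp K N (condOrder K O * N) ≤
      (Igrp K O (condOrder K O * N) ⊓ Pgrp K O N).map hO.extend by
    obtain ⟨u, ⟨hu, hu'⟩, h⟩ := this hw
    exact ⟨u, hu, hu', h⟩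
  refine (Subgroup.closure_le _).2 ?_
  rintro v ⟨ν, hν0, hν, ⟨_, b, rfl, μ, h⟩, hv⟩
  obtain ⟨x, y, rfl, hxy, hx⟩ := hO.exists_incl_eq_of_congr hν h
  have hx0 : x ≠ 0 := by rintro rfl; exact hν0 (map_zero _)
  have hM := span_singleton_mem_Mset hx0 hx
  refine ⟨hM.2.2.unit, ⟨Subgroup.subset_closure ⟨_, hM, hM.2.2.unit_spec⟩,
    Subgroup.subset_closure ⟨x, hx0, ⟨y, hxy⟩, hM.2.2.unit_spec⟩⟩, Units.ext ?_⟩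
  rw [hO.extend_coe hM.2.2.unit_spec, hv, Ideal.map_span, Set.image_singleton]

/-- An element of `P_N(O)` that is prime to `m` is a quotient of principal ideals prime to `m`
with generators congruent to `1` modulo `N`. -/
theorem IsImagQuadOrder.exists_div_of_mem_Pgrp_of_mem_Igrp (hO : IsImagQuadOrder K O) {N m : ℕ}
    (hNm : N ∣ m) {u : (Frac K O)ˣ} (hP : u ∈ Pgrp K O N) (hI : u ∈ Igrp K O m) :
    ∃ s t : (Frac K O)ˣ, u = s / t ∧
      (∃ ν μ : O, ν ≠ 0 ∧ primeTo K O m (Ideal.span {ν}) ∧ ν = 1 + (N : O) * μ ∧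
        (s : Frac K O) = ((Ideal.span {ν} : Ideal O) : Frac K O)) ∧
      ∃ ν μ : O, ν ≠ 0 ∧ primeTo K O m (Ideal.span {ν}) ∧ ν = 1 + (N : O) * μ ∧
        (t : Frac K O) = ((Ideal.span {ν} : Ideal O) : Frac K O) := by
  have := hO.isFractionRing
  obtain ⟨s, t, hst, ⟨α, hα0, ⟨α', hα⟩, hs⟩, β, hβ0, ⟨β', hβ⟩, ht⟩ :=
    exists_div_of_mem_Pgrp hP
  obtain ⟨s', t', hst', ⟨a, ha, hs'⟩, b, hb, ht'⟩ := exists_div_of_mem_Igrp hI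
  have hab : Ideal.span {α} * b = Ideal.span {β} * a := by
    refine FractionalIdeal.coeIdeal_injective (K := K) ?_
    simp only [FractionalIdeal.coeIdeal_mul, ← hs, ← ht, ← hs', ← ht', ← Units.val_mul]
    congr 1
    rw [mul_comm t, ← div_eq_div_iff_mul_eq_mul, ← hst, ← hst']
  obtain ⟨k, rfl⟩ := hNm
  obtain ⟨γ, hγ, hγ0, y, hγy⟩ := Ideal.exists_ne_zero_mem_congr_one hb.1 hb.2.1
  have hγm : primeTo K O (N * k) (Ideal.span {γ}) :=
    Ideal.sup_span_eq_top_iff.2 ⟨γ, Ideal.mem_span_singleton_self γ, y, hγy⟩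
  obtain ⟨c, hc⟩ := Ideal.exists_mul_eq_span_of_isUnit hb.2.2 hγ
  have hcm : primeTo K O (N * k) c :=
    Ideal.sup_eq_top_mono (hc ▸ Ideal.mul_le_right) dvd_rfl hγm
  obtain ⟨δ, -, hδ⟩ := Ideal.mem_span_singleton_mul.1
    (hab ▸ Ideal.mul_mem_mul (Ideal.mem_span_singleton_self α) hγ)
  have hδ0 : δ ≠ 0 := by
    rintro rfl
    exact mul_ne_zero hα0 hγ0 (by rw [← hδ, mul_zero])
  have hδac : Ideal.span {δ} = a * c := by
    rw [← Ideal.span_singleton_mul_right_inj hβ0, Ideal.span_singleton_mul_span_singleton, hδ,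
      ← mul_assoc, ← hab, mul_assoc, hc, Ideal.span_singleton_mul_span_singleton]
  have hδm : primeTo K O (N * k) (Ideal.span {δ}) := hδac ▸ Ideal.mul_sup_span_eq_top ha.2.1 hcm
  have hus := (FractionalIdeal.isUnit_coeIdeal_span_singleton (F := K) hδ0)
  have hut := (FractionalIdeal.isUnit_coeIdeal_span_singleton (F := K) hγ0)
  refine ⟨hus.unit, hut.unit, ?_,
    ⟨δ, α' + k * y + N * k * α' * y - β' * δ, hδ0, hδm, ?_, hus.unit_spec⟩,
    γ, k * y, hγ0, hγm, ?_, hut.unit_spec⟩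
  · rw [hst, div_eq_div_iff_mul_eq_mul, Units.ext_iff]
    simp only [Units.val_mul, IsUnit.unit_spec, hs, ht, ← FractionalIdeal.coeIdeal_mul,
      Ideal.span_singleton_mul_span_singleton]
    rw [← hδ, mul_comm]
  · rw [hα, hβ, hγy] at hδ
    push_cast at hδ
    linear_combination hδ
  · rw [hγy]; push_cast; ring

theorem IsImagQuadOrder.mem_Pgrp_iff (hO : IsImagQuadOrder K O) {N : ℕ} {u : (Frac K O)ˣ}
    (hu : u ∈ Igrp K O (condOrder K O * N)) :
    u ∈ Pgrp K O N ↔ hO.extend u ∈ PZgrp K N (condOrder K O * N) := by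
  constructor
  · intro h
    obtain ⟨s, t, rfl, ⟨ν, μ, h0, hν, h, hs⟩, ν', μ', h0', hν', h', ht⟩ :=
      hO.exists_div_of_mem_Pgrp_of_mem_Igrp (dvd_mul_left _ _) h hu
    rw [map_div]
    exact div_mem (hO.extend_mem_PZgrp_of_eq_span h0 hν h hs)
      (hO.extend_mem_PZgrp_of_eq_span h0' hν' h' ht)
  · intro h
    obtain ⟨v, hv, hvP, hvu⟩ := hO.exists_extend_eq_of_mem_PZgrp h
    have : u / v = 1 := hO.eq_one_of_extend_eq_one (dvd_mul_right _ N) (div_mem hu hv)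
      (by rw [map_div, hvu, div_self'])
    rwa [div_eq_one.1 this]

/-- Every class of `C_N(O)` is represented by an ideal prime to `m`. -/
theorem IsImagQuadOrder.exists_div_mem_Pgrp (hO : IsImagQuadOrder K O) {N m : ℕ} (hm : m ≠ 0)
    {u : (Frac K O)ˣ} (hu : u ∈ Igrp K O N) : ∃ v ∈ Igrp K O m, v / u ∈ Pgrp K O N := by
  have := hO.isFractionRing
  have := hO.moduleFinite
  suffices h : ∀ s : (Frac K O)ˣ, (∃ a ∈ Mset K O N, (s : Frac K O) = a) →
      ∃ v ∈ Igrp K O m, v / s ∈ Pgrp K O N by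
    obtain ⟨s, t, rfl, hs, ht⟩ := exists_div_of_mem_Igrp hu
    obtain ⟨v, hv, hvs⟩ := h s hs
    obtain ⟨w, hw, hwt⟩ := h t ht
    refine ⟨v / w, div_mem hv hw, ?_⟩
    rw [div_div_div_comm]
    exact div_mem hvs hwt
  rintro s ⟨a, ha, hs⟩
  have hm' : (m : O) ≠ 0 := by exact_mod_cast hm
  obtain ⟨x, hx, hx0, hxN, hxP⟩ := Ideal.exists_mem_congr_one_forall_notMem_mul
    (Ideal.finite_setOf_isMaximal_mem hm') ha.1 ha.2.1
    (fun P hP ↦ Ideal.mul_ne_self_of_isUnit ha.2.2 hP.ne_top)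
  obtain ⟨c, hc⟩ := Ideal.exists_mul_eq_span_of_isUnit ha.2.2 hx
  have hcu := (Ideal.isUnit_coeIdeal_and_of_mul_eq_span (F := K) hx0 hc).2
  have hcm : primeTo K O m c := by
    by_contra h
    obtain ⟨P, hP, hle⟩ := Ideal.exists_le_maximal _ h
    rw [sup_le_iff, Ideal.span_singleton_le_iff_mem] at hle
    refine hxP P hP hle.2 (Ideal.mul_mono_right hle.1 ?_)
    rw [hc]
    exact Ideal.mem_span_singleton_self x
  refine ⟨hcu.unit⁻¹, inv_mem (Subgroup.subset_closure
    ⟨c, ⟨Ideal.ne_bot_of_isUnit_coeIdeal hcu, hcm, hcu⟩, hcu.unit_spec⟩), ?_⟩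
  rw [← inv_mem_iff, inv_div, div_inv_eq_mul]
  refine Subgroup.subset_closure ⟨x, hx0, hxN, ?_⟩
  rw [Units.val_mul, hs, IsUnit.unit_spec, ← FractionalIdeal.coeIdeal_mul, hc]

end ClassGroups

theorem statement2 (K : Type) [Field K] [NumberField K]
    (O : Subalgebra ℤ K) (hO : IsImagQuadOrder K O) (N : ℕ) (hN : 0 < N) :
    Nonempty (ClsGrp K O N ≃* GenClsGrp K N (condOrder K O * N)) := by
  set m := condOrder K O * N with hm
  let f : Igrp K O m →* ClsGrp K O N :=
    (QuotientGroup.mk' _).comp (Subgroup.inclusion (Igrp_anti (dvd_mul_left _ _)))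
  let g : Igrp K O m →* GenClsGrp K N m :=
    (QuotientGroup.mk' _).comp ((hO.extend.comp (Igrp K O m).subtype).codRestrict _
      fun u ↦ hO.extend_mem_Igrp u.2)
  have hf : Function.Surjective f := by
    intro q
    obtain ⟨⟨u, hu⟩, rfl⟩ := QuotientGroup.mk_surjective q
    obtain ⟨v, hv, hvu⟩ := hO.exists_div_mem_Pgrp (m := m)
      (mul_ne_zero hO.condOrder_ne_zero hN.ne') hu
    refine ⟨⟨v, hv⟩, (QuotientGroup.eq_iff_div_mem).2 ?_⟩
    exact Subgroup.mem_subgroupOf.2 hvu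
  have hg : Function.Surjective g := by
    intro q
    obtain ⟨⟨w, hw⟩, rfl⟩ := QuotientGroup.mk_surjective q
    obtain ⟨u, hu, rfl⟩ := hO.exists_extend_eq (dvd_mul_right _ _) hw
    exact ⟨⟨u, hu⟩, rfl⟩
  have hfg : f.ker = g.ker := by
    ext ⟨u, hu⟩
    rw [MonoidHom.mem_ker, MonoidHom.mem_ker]
    refine (QuotientGroup.eq_one_iff _).trans (Iff.trans ?_ (QuotientGroup.eq_one_iff _).symm)
    exact hO.mem_Pgrp_iff hu
  exact ⟨(QuotientGroup.quotientKerEquivOfSurjective f hf).symm.trans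
    ((QuotientGroup.quotientMulEquivOfEq hfg).trans
      (QuotientGroup.quotientKerEquivOfSurjective g hg))⟩
end
end

section
/- Let K be an imaginary quadratic field, O an order in K of conductor ℓ_O, and N a positive integer. For every nonzero ν ∈ O_K, the following are equivalent: (1) ν ∈ O, the ideal νO is prime to ℓ_O N, and ν ≡ 1 (mod NO); (2) the ideal νO_K is prime to ℓ_O N, and there exists an integer a with a ≡ 1 (mod N) such that ν ≡ a (mod ℓ_O N O_K). -/
open scoped nonZeroDivisors

set_option synthInstance.maxHeartbeats 1000000
set_option maxHeartbeats 1000000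

noncomputable section

variable (K : Type) [Field K] [NumberField K]

/-!
STATEMENT 6: for every nonzero `ν ∈ O_K`, the following are equivalent:
(1) `ν ∈ O`, the ideal `νO` is prime to `ℓ_O N`, and `ν ≡ 1 (mod NO)`;
(2) the ideal `νO_K` is prime to `ℓ_O N`, and there is an integer `a ≡ 1 (mod N)` with
    `ν ≡ a (mod ℓ_O N O_K)`.
-/

open NumberField in
/-- An integer multiple of an algebraic integer `x` is a rational integer only if `x` is. -/
lemma mem_range_algebraMap_of_mul_eq (K : Type*) [Field K] [NumberField K] {n m : ℤ} {x : 𝓞 K}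
    (hn : n ≠ 0) (h : (n : 𝓞 K) * x = m) : ∃ k : ℤ, (k : 𝓞 K) = x := by
  have hK : (n : K) * (x : K) = m := by
    simpa using congrArg (algebraMap (𝓞 K) K) h
  have hn' : (n : K) ≠ 0 := by exact_mod_cast hn
  have hx : algebraMap ℚ K (m / n) = x := by
    rw [map_div₀, map_intCast, map_intCast, ← hK, mul_div_cancel_left₀ _ hn']
  have hint : IsIntegral ℤ ((m : ℚ) / n) := by
    rw [← isIntegral_algebraMap_iff (algebraMap ℚ K).injective, hx]
    exact RingOfIntegers.isIntegral_coe x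
  obtain ⟨k, hk⟩ := IsIntegrallyClosed.isIntegral_iff.mp hint
  refine ⟨k, RingOfIntegers.ext ?_⟩
  rw [← hx, ← hk]
  simp

open NumberField in
/-- The ring of integers of a quadratic field has an integral basis of the form `1, ω`. -/
lemma exists_integral_generator (K : Type*) [Field K] [NumberField K]
    (hK : Module.finrank ℚ K = 2) : ∃ ω : 𝓞 K, ∀ x : 𝓞 K, ∃ a b : ℤ, x = a + b * ω := by
  set P : Submodule ℤ (𝓞 K) := LinearMap.range (Algebra.linearMap ℤ (𝓞 K))
  have htf : Module.IsTorsionFree ℤ (𝓞 K ⧸ P) := by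
    rw [Module.isTorsionFree_iff_smul_eq_zero]
    intro n q
    obtain ⟨x, rfl⟩ := Submodule.Quotient.mk_surjective P q
    rw [← Submodule.Quotient.mk_smul, Submodule.Quotient.mk_eq_zero,
      Submodule.Quotient.mk_eq_zero]
    rintro ⟨m, hm⟩
    refine or_iff_not_imp_left.mpr fun hn => ?_
    obtain ⟨k, hk⟩ := mem_range_algebraMap_of_mul_eq K (n := n) (m := m) (x := x) hn
      (by simpa using hm.symm)
    exact ⟨k, by simpa using hk⟩
  have hrank : Module.finrank ℤ (𝓞 K ⧸ P) = 1 := by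
    have h1 := P.finrank_quotient_add_finrank
    have h2 : Module.finrank ℤ P = 1 := by
      rw [LinearMap.finrank_range_of_inj (f := Algebra.linearMap ℤ (𝓞 K))
        (fun a b h => by simpa using h), Module.finrank_self]
    rw [RingOfIntegers.rank, hK] at h1
    omega
  obtain ⟨b⟩ := (finrank_eq_one_iff Unit).mp hrank
  obtain ⟨ω, hω⟩ := Submodule.Quotient.mk_surjective P (b ())
  refine ⟨ω, fun x => ?_⟩
  have hx := b.sum_repr (Submodule.Quotient.mk x)
  rw [Fintype.sum_unique] at hx
  set c := b.repr (Submodule.Quotient.mk x) default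
  rw [show b default = _ from hω.symm, ← Submodule.Quotient.mk_smul] at hx
  obtain ⟨a, ha⟩ := (Submodule.Quotient.eq P).mp hx.symm
  refine ⟨a, c, ?_⟩
  have : (a : 𝓞 K) = x - c • ω := by simpa using ha
  rw [this, zsmul_eq_mul, sub_add_cancel]

/-- The conductor of `O` multiplies the maximal order into `O`. -/
lemma condOrder_mul_mem (K : Type) [Field K] [NumberField K] (O : Subalgebra ℤ K)
    (x : integralClosure ℤ K) : (condOrder K O : K) * x ∈ O := by
  have := AddSubgroup.nsmul_index_mem
    ((Subalgebra.toSubmodule O).toAddSubgroup.addSubgroupOf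
      (Subalgebra.toSubmodule (integralClosure ℤ K)).toAddSubgroup) x
  rw [AddSubgroup.mem_addSubgroupOf] at this
  rw [← nsmul_eq_mul]
  exact this

/-- An order of conductor `ℓ` in a quadratic field is contained in `ℤ + ℓ O_K`. -/
lemma IsImagQuadOrder.exists_eq_add_condOrder_mul {K : Type} [Field K] [NumberField K]
    {O : Subalgebra ℤ K} (hO : IsImagQuadOrder K O) {x : K} (hx : x ∈ O) :
    ∃ (b : ℤ) (γ : integralClosure ℤ K), x = b + (condOrder K O : K) * γ := by
  obtain ⟨ω, hω⟩ := exists_integral_generator K hO.degree_two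
  let ω' : integralClosure ℤ K := ω
  have hω' (y : integralClosure ℤ K) : ∃ a b : ℤ, y = a + b * ω' := hω y
  let H : AddSubgroup (integralClosure ℤ K) :=
    (Subalgebra.toSubmodule O).toAddSubgroup.addSubgroupOf
      (Subalgebra.toSubmodule (integralClosure ℤ K)).toAddSubgroup
  have hmem (y : integralClosure ℤ K) : y ∈ H ↔ (y : K) ∈ O := Iff.rfl
  have hint (a : ℤ) : ((a : integralClosure ℤ K)) ∈ H := by
    rw [hmem]
    simp
  let g : integralClosure ℤ K ⧸ H := QuotientAddGroup.mk ω'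
  have hgen : ∀ q : integralClosure ℤ K ⧸ H, q ∈ AddSubgroup.zmultiples g := by
    intro q
    obtain ⟨y, rfl⟩ := QuotientAddGroup.mk_surjective q
    obtain ⟨a, b, rfl⟩ := hω' y
    refine ⟨b, ?_⟩
    change (QuotientAddGroup.mk (b • ω') : integralClosure ℤ K ⧸ H) = _
    rw [QuotientAddGroup.eq]
    simpa [zsmul_eq_mul, add_comm] using hint a
  have hord : addOrderOf g = condOrder K O := addOrderOf_eq_card_of_forall_mem_zmultiples hgen
  have hint_x : x ∈ integralClosure ℤ K := IsIntegral.of_mem_of_fg O hO.fg x hx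
  obtain ⟨a, b, hab⟩ := hω' ⟨x, hint_x⟩
  have hb : b • g = 0 := by
    change (QuotientAddGroup.mk (b • ω') : integralClosure ℤ K ⧸ H) = 0
    rw [QuotientAddGroup.eq_zero_iff]
    have h1 := H.sub_mem ((hmem ⟨x, hint_x⟩).mpr hx) (hint a)
    rw [hab] at h1
    simpa [zsmul_eq_mul] using h1
  rw [← addOrderOf_dvd_iff_zsmul_eq_zero, hord] at hb
  obtain ⟨c, rfl⟩ := hb
  refine ⟨a, c * ω', ?_⟩
  have := congrArg (Subtype.val) hab
  push_cast at this ⊢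
  rw [this]
  ring

/-- A principal ideal is prime to `m` iff its generator is coprime to `m`. -/
lemma primeTo_span_singleton_iff (K : Type) [Field K] [NumberField K] (O : Subalgebra ℤ K)
    (m : ℕ) (ν : O) : primeTo K O m (Ideal.span {ν}) ↔ IsCoprime ν (m : O) := by
  rw [primeTo, ← Ideal.isCoprime_iff_sup_eq, Ideal.isCoprime_span_singleton_iff]

/-- Rational integers which are coprime in the maximal order are coprime. -/
lemma isCoprime_of_isCoprime_integralClosure (K : Type*) [Field K] [NumberField K] {a m : ℤ}
    (h : IsCoprime (a : integralClosure ℤ K) (m : integralClosure ℤ K)) : IsCoprime a m := by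
  rw [Int.isCoprime_iff_gcd_eq_one, ← Nat.isUnit_iff, ← Int.ofNat_isUnit]
  refine isUnit_of_map_unit (algebraMap ℤ (integralClosure ℤ K)) _ ?_
  refine h.isUnit_of_dvd' ?_ ?_
  · simpa using (algebraMap ℤ (integralClosure ℤ K)).map_dvd (Int.gcd_dvd_left a m)
  · simpa using (algebraMap ℤ (integralClosure ℤ K)).map_dvd (Int.gcd_dvd_right a m)

theorem statement6 (K : Type) [Field K] [NumberField K]
    (O : Subalgebra ℤ K) (hO : IsImagQuadOrder K O) (N : ℕ) (hN : 0 < N)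
    (ν : ((integralClosure ℤ K : Subalgebra ℤ K) : Type)) (hν : ν ≠ 0) :
    (∃ hmem : (ν : K) ∈ O,
        primeTo K O (condOrder K O * N)
          (Ideal.span {(⟨(ν : K), hmem⟩ : (O : Type))}) ∧
        ∃ μ : (O : Type),
          (⟨(ν : K), hmem⟩ : (O : Type)) = 1 + (N : (O : Type)) * μ) ↔
      (primeTo K (integralClosure ℤ K) (condOrder K O * N) (Ideal.span {ν}) ∧
        ∃ a b : ℤ, a = 1 + (N : ℤ) * b ∧
          ∃ μ : ((integralClosure ℤ K : Subalgebra ℤ K) : Type),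
            ν = (a : ((integralClosure ℤ K : Subalgebra ℤ K) : Type))
                + ((condOrder K O * N : ℕ) : ((integralClosure ℤ K : Subalgebra ℤ K) : Type)) * μ) := by
  have hle : O ≤ integralClosure ℤ K := fun x hx => IsIntegral.of_mem_of_fg O hO.fg x hx
  simp only [primeTo_span_singleton_iff]
  constructor
  · rintro ⟨hmem, hcop, μ, hμ⟩
    refine ⟨?_, ?_⟩
    · have h := hcop.map (Subalgebra.inclusion hle).toRingHom
      simpa using h
    · obtain ⟨b, γ, hγ⟩ := hO.exists_eq_add_condOrder_mul μ.2
      refine ⟨1 + N * b, b, rfl, γ, Subtype.ext ?_⟩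
      have h := congrArg Subtype.val hμ
      push_cast at h ⊢
      rw [h, hγ]
      ring
  · rintro ⟨hcop, a, b, hab, γ, hγ⟩
    have hγK : (ν : K) = 1 + N * (b + condOrder K O * γ) := by
      have h := congrArg Subtype.val hγ
      rw [hab] at h
      push_cast at h
      rw [h]
      ring
    have hμ : (b + condOrder K O * γ : K) ∈ O :=
      O.add_mem (intCast_mem O b) (condOrder_mul_mem K O γ)
    have hmem : (ν : K) ∈ O := by
      rw [hγK]
      exact O.add_mem O.one_mem (O.mul_mem (natCast_mem O N) hμ)
    refine ⟨hmem, ?_, ⟨_, hμ⟩, Subtype.ext (by push_cast; exact hγK)⟩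
    have ham : IsCoprime a ((condOrder K O * N : ℕ) : ℤ) := by
      apply isCoprime_of_isCoprime_integralClosure K
      rw [hγ] at hcop
      rw [Int.cast_natCast]
      exact IsCoprime.of_add_mul_left_left hcop
    have haO : IsCoprime (a : O) ((condOrder K O * N : ℕ) : O) := by
      simpa using ham.map (Int.castRingHom O)
    set ν' : O := ⟨ν, hmem⟩
    have hsq : (a : O) ^ 2 = ν' * (a + (a - ν')) + ((condOrder K O * N : ℕ) : O) *
        (N * ⟨_, condOrder_mul_mem K O (γ ^ 2)⟩) := by
      have h := congrArg Subtype.val hγ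
      apply Subtype.ext
      push_cast at h ⊢
      rw [h]
      ring
    have h2 : IsCoprime ((a : O) ^ 2) ((condOrder K O * N : ℕ) : O) := haO.pow_left
    rw [hsq] at h2
    exact (IsCoprime.of_add_mul_left_left h2).of_mul_left_left
end
end
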